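/- Let n₁, n₂ ∈ ℕ, m ≥ 1 an integer, f : 𝔽₂^{n₁} → 𝔽₂ and g : 𝔽₂^{n₂} → 𝔽₂. Define h : 𝔽₂^{n₁} × 𝔽₂^{n₂} → 𝔽₂ by h(x, y) = f(x) ⊕ g(y). Then for all u ∈ 𝔽₂^{n₁} and v ∈ 𝔽₂^{n₂}, the m-Hadamard transform of h on n₁ + n₂ variables (with the Hamming weight of the pair (x, y) equal to wt(x) + wt(y) and (x,y)·(u,v) = x·u ⊕ y·v) satisfies H^(m)_h(u, v) = H^(m)_f(u) · H^(m)_g(v). -/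

import Mathlib

open Finset

noncomputable section

/-- Sign character: `(-1)^v ∈ ℂ` for `v ∈ 𝔽₂`. -/
def sgn (v : ZMod 2) : ℂ := if v = 0 then 1 else -1

/-- Hamming weight of `x ∈ 𝔽₂ⁿ`. -/
def wt {n : ℕ} (x : Fin n → ZMod 2) : ℕ := (Finset.univ.filter (fun i => x i = 1)).card

/-- Dot product `x·y = ⊕ᵢ xᵢyᵢ ∈ 𝔽₂`. -/
def dotp {n : ℕ} (x y : Fin n → ZMod 2) : ZMod 2 := ∑ i, x i * y i

/-- `x⊙y ∈ ℕ`: number of indices with `xᵢ = yᵢ = 1`. -/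
def odot {n : ℕ} (x y : Fin n → ZMod 2) : ℕ :=
  (Finset.univ.filter (fun i => x i = 1 ∧ y i = 1)).card

/-- `ζ_m = exp(2πi/m)`. -/
def zeta (m : ℕ) : ℂ := Complex.exp (2 * Real.pi * Complex.I / m)

/-- The `m`-Hadamard transform of `f` at `ω`. -/
def mHad (m : ℕ) {n : ℕ} (f : (Fin n → ZMod 2) → ZMod 2) (ω : Fin n → ZMod 2) : ℂ :=
  ((Real.sqrt 2 : ℂ) ^ n)⁻¹ *
    ∑ x : Fin n → ZMod 2, sgn (f x + dotp x ω) * zeta m ^ wt x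

/-- The `m`-crosscorrelation of `f` and `g` at `y`. -/
def mCross (m : ℕ) {n : ℕ} (f g : (Fin n → ZMod 2) → ZMod 2) (y : Fin n → ZMod 2) : ℂ :=
  ∑ x : Fin n → ZMod 2, sgn (f x + g (x + y)) * (zeta m ^ 2) ^ odot x y

/-- The (3-fold) `m`-Forrelation of `f₁, f₂, f₃`. -/
def mForr (m : ℕ) {n : ℕ} (f₁ f₂ f₃ : (Fin n → ZMod 2) → ZMod 2) : ℂ :=
  ((2 : ℂ) ^ n)⁻¹ *
    ∑ x : Fin n → ZMod 2, sgn (f₁ x) * mHad m f₂ x * (starRingEnd ℂ) (mHad m f₃ x)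

/-- The Walsh–Hadamard transform of `f` at `ω`. -/
def walsh {n : ℕ} (f : (Fin n → ZMod 2) → ZMod 2) (ω : Fin n → ZMod 2) : ℂ :=
  ((Real.sqrt 2 : ℂ) ^ n)⁻¹ * ∑ x : Fin n → ZMod 2, sgn (f x + dotp x ω)

/-- The nega-Hadamard transform of `f` at `ω`. -/
def negaHad {n : ℕ} (f : (Fin n → ZMod 2) → ZMod 2) (ω : Fin n → ZMod 2) : ℂ :=
  ((Real.sqrt 2 : ℂ) ^ n)⁻¹ *
    ∑ x : Fin n → ZMod 2, sgn (f x + dotp x ω) * Complex.I ^ wt x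

/-- The elementary symmetric quadratic Boolean function `s₂`. -/
def s2 {n : ℕ} (x : Fin n → ZMod 2) : ZMod 2 :=
  ∑ i : Fin n, ∑ j ∈ Finset.univ.filter (fun j => i < j), x i * x j

/-- The linear function `L_u(x) = ⊕ᵢ xᵢ · (⊕_{j ≠ i} uⱼ)`. -/
def Lfun {n : ℕ} (u x : Fin n → ZMod 2) : ZMod 2 :=
  ∑ i : Fin n, x i * ∑ j ∈ Finset.univ.filter (fun j => j ≠ i), u j

end

theorem sgn_add_mul (a b : ZMod 2) : sgn (a + b) = sgn a * sgn b := by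
  have key : ∀ c : ZMod 2, c = 0 ∨ c = 1 := by decide
  have h2 : (1 + 1 : ZMod 2) = 0 := by decide
  rcases key a with rfl | rfl <;> rcases key b with rfl | rfl <;> simp [sgn, h2]

theorem stmt18 (n₁ n₂ m : ℕ) (hm : 1 ≤ m)
    (f : (Fin n₁ → ZMod 2) → ZMod 2) (g : (Fin n₂ → ZMod 2) → ZMod 2)
    (h : (Fin n₁ → ZMod 2) × (Fin n₂ → ZMod 2) → ZMod 2)
    (hh : ∀ x y, h (x, y) = f x + g y) :
    ∀ (u : Fin n₁ → ZMod 2) (v : Fin n₂ → ZMod 2),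
      ((Real.sqrt 2 : ℂ) ^ (n₁ + n₂))⁻¹ *
          ∑ x : Fin n₁ → ZMod 2, ∑ y : Fin n₂ → ZMod 2,
            sgn (h (x, y) + (dotp x u + dotp y v)) * zeta m ^ (wt x + wt y) =
        mHad m f u * mHad m g v := by
  intro u v
  unfold mHad
  rw [mul_mul_mul_comm, Finset.sum_mul_sum, pow_add, mul_inv]
  congr 1
  refine Finset.sum_congr rfl fun x _ => Finset.sum_congr rfl fun y _ => ?_
  rw [hh, add_add_add_comm, sgn_add_mul, pow_add, mul_mul_mul_comm]
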